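/- Let μ be the Haar (coin-flipping) probability measure on 2^ω, and let f_n : (2^ω)^ω → 2 be μ^ω-measurable functions (with 2 discrete). Then there exist an infinite set N ⊆ ω and nonempty perfect sets P_k ⊆ 2^ω such that (f_n)_{n∈N} converges pointwise on ∏_{k∈ω} P_k. -/

import Mathlib

open Filter MeasureTheory

/-- The configurations `y ∈ B` such that `y` with coordinate `p` replaced by coordinate `q` is
still in `B`. -/
def dbl {ι α : Type*} [DecidableEq ι] (p q : ι) (B : Set (ι → α)) : Set (ι → α) :=
  {y | y ∈ B ∧ Function.update y p (y q) ∈ B}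

/-- Membership in `B` does not depend on the coordinate `q`. -/
def IndepCoord {ι α : Type*} [DecidableEq ι] (q : ι) (B : Set (ι → α)) : Prop :=
  ∀ y v, Function.update y q v ∈ B ↔ y ∈ B

section Combinatorics

variable {ι α : Type*} [DecidableEq ι] {p q r : ι} {A B : Set (ι → α)}

theorem dbl_subset : dbl p q B ⊆ B := fun _ h => h.1

theorem dbl_mono (h : A ⊆ B) : dbl p q A ⊆ dbl p q B := fun _ hy => ⟨h hy.1, h hy.2⟩

theorem dbl_inter : dbl p q (A ∩ B) = dbl p q A ∩ dbl p q B := by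
  ext y; simp only [dbl, Set.mem_inter_iff, Set.mem_ofPred_eq]; tauto

theorem isClosed_dbl [TopologicalSpace α] (h : IsClosed B) : IsClosed (dbl p q B) :=
  h.inter (h.preimage (f := fun y : ι → α => Function.update y p (y q)) (by fun_prop))

theorem measurableSet_dbl [MeasurableSpace α] (h : MeasurableSet B) :
    MeasurableSet (dbl p q B) := by
  refine h.inter (?_ : MeasurableSet ((fun y : ι → α => Function.update y p (y q)) ⁻¹' B))
  refine measurableSet_preimage (measurable_pi_lambda _ fun i => ?_) h
  by_cases hi : i = p
  · subst hi; simpa using measurable_pi_apply q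
  · simpa [Function.update_of_ne hi] using measurable_pi_apply i

theorem IndepCoord.inter (hA : IndepCoord q A) (hB : IndepCoord q B) : IndepCoord q (A ∩ B) :=
  fun y v => and_congr (hA y v) (hB y v)

theorem IndepCoord.dbl (hB : IndepCoord r B) (hp : r ≠ p) (hq : r ≠ q) :
    IndepCoord r (dbl p q B) := by
  intro y v
  refine and_congr (hB y v) ?_
  rw [Function.update_of_ne hq.symm, Function.update_comm hp, hB]

end Combinatorics

section Measure

variable {ι α : Type*} [DecidableEq ι] [MeasurableSpace α] {μ : Measure α}
  [IsProbabilityMeasure μ]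

theorem measurable_update_prod (q : ι) :
    Measurable (fun z : (ι → α) × α => Function.update z.1 q z.2) := by
  refine measurable_pi_lambda _ fun i => ?_
  by_cases hi : i = q
  · subst hi; simpa using measurable_snd
  · simpa [Function.update_of_ne hi] using measurable_fst.eval (a := i)

/-- Resampling one coordinate preserves the product measure. -/
theorem measurePreserving_update_infinitePi (q : ι) :
    MeasurePreserving (fun z : (ι → α) × α => Function.update z.1 q z.2)
      ((Measure.infinitePi fun _ : ι => μ).prod μ) (Measure.infinitePi fun _ : ι => μ) := by
  refine ⟨measurable_update_prod q, Measure.eq_infinitePi _ fun s t ht => ?_⟩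
  rw [Measure.map_apply (measurable_update_prod q)
    (MeasurableSet.pi s.countable_toSet fun i _ => ht i)]
  by_cases hq : q ∈ s
  · have : (fun z : (ι → α) × α => Function.update z.1 q z.2) ⁻¹' Set.pi s t
        = (Set.pi (s.erase q : Finset ι) t) ×ˢ t q := by
      ext ⟨y, v⟩
      simp only [Set.mem_preimage, Set.mem_pi, Set.mem_prod, Finset.mem_coe, Finset.mem_erase]
      constructor
      · intro h
        exact ⟨fun i hi => by simpa [Function.update_of_ne hi.1] using h i hi.2,
          by simpa using h q hq⟩
      · rintro ⟨h, hv⟩ i hi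
        by_cases hiq : i = q
        · subst hiq; simpa using hv
        · simpa [Function.update_of_ne hiq] using h i ⟨hiq, hi⟩
    rw [this, Measure.prod_prod, Measure.infinitePi_pi _ (fun i _ => ht i),
      Finset.prod_erase_mul _ _ hq]
  · have : (fun z : (ι → α) × α => Function.update z.1 q z.2) ⁻¹' Set.pi s t
        = (Set.pi s t) ×ˢ Set.univ := by
      ext ⟨y, v⟩
      simp only [Set.mem_preimage, Set.mem_pi, Set.mem_prod, Finset.mem_coe, Set.mem_univ,
        and_true]
      refine forall₂_congr fun i hi => ?_
      rw [Function.update_of_ne (by rintro rfl; exact hq hi)]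
    rw [this, Measure.prod_prod, Measure.infinitePi_pi _ (fun i _ => ht i), measure_univ, mul_one]

theorem measure_infinitePi_eq_lintegral_update (q : ι) {B : Set (ι → α)} (hB : MeasurableSet B) :
    (Measure.infinitePi fun _ : ι => μ) B
      = ∫⁻ y, μ {v | Function.update y q v ∈ B} ∂(Measure.infinitePi fun _ : ι => μ) := by
  rw [← (measurePreserving_update_infinitePi q).measure_preimage hB.nullMeasurableSet,
    Measure.prod_apply (measurable_update_prod q hB)]
  rfl

/-- The measure of the doubling along a fresh coordinate is at least the square of the measure. -/
theorem sq_le_measure_dbl {p q : ι} (hpq : p ≠ q) {B : Set (ι → α)} (hB : MeasurableSet B)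
    (hq : IndepCoord q B) :
    (Measure.infinitePi fun _ : ι => μ) B ^ 2
      ≤ (Measure.infinitePi fun _ : ι => μ) (dbl p q B) := by
  set ν := Measure.infinitePi fun _ : ι => μ with hν
  set g : (ι → α) → ENNReal := fun y => μ {v | Function.update y p v ∈ B} with hg
  have hgm : Measurable g := measurable_measure_prodMk_left (measurable_update_prod p hB)
  have hgp : ∀ y u, g (Function.update y p u) = g y := by
    intro y u; simp [hg]
  have hgB : ν B = ∫⁻ y, g y ∂ν := measure_infinitePi_eq_lintegral_update p hB
  have h1 : ν (dbl p q B) = ∫⁻ y, B.indicator 1 y * g y ∂ν := by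
    rw [measure_infinitePi_eq_lintegral_update q (measurableSet_dbl hB)]
    refine lintegral_congr fun y => ?_
    have : ∀ v, Function.update y q v ∈ dbl p q B ↔ y ∈ B ∧ Function.update y p v ∈ B := by
      intro v
      refine and_congr (hq y v) ?_
      rw [Function.update_self, Function.update_comm hpq.symm, hq]
    simp only [this]
    by_cases hy : y ∈ B <;> simp [hy, hg]
  have h2 : ∫⁻ y, B.indicator 1 y * g y ∂ν = ∫⁻ y, g y * g y ∂ν := by
    have hm : Measurable fun y => B.indicator 1 y * g y :=
      (measurable_one.indicator hB).mul hgm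
    rw [← (measurePreserving_update_infinitePi p).lintegral_comp hm,
      lintegral_prod (fun z : (ι → α) × α => B.indicator 1 (Function.update z.1 p z.2)
        * g (Function.update z.1 p z.2)) (hm.comp (measurable_update_prod p)).aemeasurable]
    refine lintegral_congr fun y => ?_
    simp only [hgp]
    have hmB : MeasurableSet {v | Function.update y p v ∈ B} :=
      measurable_prodMk_left (measurable_update_prod p hB)
    have hind : ∀ v, B.indicator (1 : (ι → α) → ENNReal) (Function.update y p v)
        = {v | Function.update y p v ∈ B}.indicator 1 v := fun v => rfl
    simp only [hind]
    rw [lintegral_mul_const _ (measurable_one.indicator hmB), lintegral_indicator_one hmB]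
  rw [h1, h2]
  set c := ν B with hc
  have hcfin : c ≠ ⊤ := measure_ne_top _ _
  have h3 : 2 * c * c ≤ (∫⁻ y, g y * g y ∂ν) + c ^ 2 := by
    have h4 : ∫⁻ y, 2 * c * g y ∂ν ≤ ∫⁻ y, (g y * g y + c ^ 2) ∂ν := by
      refine lintegral_mono fun y => ?_
      rcases eq_or_ne (g y) ⊤ with hy | hy
      · simp [hy]
      · lift g y to NNReal using hy with x
        lift c to NNReal using hcfin with c
        have := two_mul_le_add_sq c x
        rw [add_comm, sq x] at this
        exact_mod_cast this
    rwa [lintegral_const_mul _ hgm, ← hgB, lintegral_add_right _ measurable_const,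
      lintegral_const, measure_univ, mul_one] at h4
  have : c ^ 2 + c ^ 2 ≤ (∫⁻ y, g y * g y ∂ν) + c ^ 2 := by
    rwa [← two_mul, sq c, ← mul_assoc, ← sq c]
  exact (ENNReal.add_le_add_iff_right (ENNReal.pow_ne_top hcfin)).1 this

end Measure

/-- Sets of measure bounded below along a nonprincipal ultrafilter have pairwise
intersections of measure bounded below. -/
theorem exists_eventually_le_measure_inter {Ω : Type*} [MeasurableSpace Ω] (ν : Measure Ω)
    [IsFiniteMeasure ν] (U : Ultrafilter ℕ) (hU : (U : Filter ℕ) ≤ atTop) (B : ℕ → Set Ω)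
    (hB : ∀ i, MeasurableSet (B i))
    {c : ENNReal} (hc : c ≠ 0) (h : ∀ᶠ i in (U : Filter ℕ), c ≤ ν (B i)) (n : ℕ) :
    ∃ j > n, ∃ d : ENNReal, d ≠ 0 ∧ ∀ᶠ i in (U : Filter ℕ), d ≤ ν (B j ∩ B i) := by
  by_contra! hcon
  have hcfin : c ≠ ⊤ := by
    obtain ⟨i, hi⟩ := h.exists
    exact ne_top_of_le_ne_top (measure_ne_top _ _) hi
  set V : ℕ → Set Ω := fun N => ⋃ j ∈ Finset.Ioc n N, B j with hV
  have hVm : Monotone V := fun a b hab =>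
    Set.biUnion_subset_biUnion_left (Finset.Ioc_subset_Ioc_right hab)
  have hVmeas : ∀ N, MeasurableSet (V N) := fun N => Finset.measurableSet_biUnion _ fun j _ => hB j
  have hlim : Tendsto (fun N => ν ((⋃ N, V N) \ V N)) atTop (nhds 0) := by
    have := tendsto_measure_iInter_atTop (μ := ν) (s := fun N => (⋃ N, V N) \ V N)
      (fun N => ((MeasurableSet.iUnion hVmeas).diff (hVmeas N)).nullMeasurableSet)
      (fun a b hab => Set.sdiff_subset_sdiff_right (hVm hab)) ⟨0, measure_ne_top _ _⟩
    rwa [← Set.sdiff_iUnion, Set.sdiff_self, measure_empty] at this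
  obtain ⟨N, hN⟩ := (hlim.eventually_lt_const (ENNReal.half_pos hc)).exists
  set e : ENNReal := c / 2 / (Finset.Ioc n N).card with he
  have he0 : e ≠ 0 := ENNReal.div_ne_zero.2 ⟨(ENNReal.half_pos hc).ne', ENNReal.natCast_ne_top _⟩
  have hsmall : ∀ᶠ i in (U : Filter ℕ), ∀ j ∈ Finset.Ioc n N, ν (B j ∩ B i) < e := by
    rw [eventually_all_finset]
    intro j hj
    exact hcon j (Finset.mem_Ioc.1 hj).1 e he0
  have hbig : ∀ᶠ i in (U : Filter ℕ), n < i := hU (eventually_gt_atTop n)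
  obtain ⟨i, hi, hs, hni⟩ := (h.and (hsmall.and hbig)).exists
  have hBi : B i ⊆ ((⋃ N, V N) \ V N) ∪ ⋃ j ∈ Finset.Ioc n N, (B j ∩ B i) := by
    intro x hx
    by_cases hxV : x ∈ V N
    · right
      simp only [hV, Set.mem_iUnion] at hxV ⊢
      obtain ⟨j, hj, hxj⟩ := hxV
      exact ⟨j, hj, hxj, hx⟩
    · left
      refine ⟨Set.mem_iUnion.2 ⟨i, ?_⟩, hxV⟩
      exact Set.mem_biUnion (Finset.mem_coe.2 (Finset.mem_Ioc.2 ⟨hni, le_rfl⟩)) hx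
  have : ν (B i) < c := by
    calc ν (B i) ≤ ν ((⋃ N, V N) \ V N) + ν (⋃ j ∈ Finset.Ioc n N, (B j ∩ B i)) :=
          (measure_mono hBi).trans (measure_union_le _ _)
      _ ≤ ν ((⋃ N, V N) \ V N) + ∑ j ∈ Finset.Ioc n N, ν (B j ∩ B i) :=
          add_le_add_right (measure_biUnion_finset_le _ _) _
      _ ≤ ν ((⋃ N, V N) \ V N) + c / 2 := by
          refine add_le_add_right ?_ _
          refine (Finset.sum_le_card_nsmul _ _ e fun j hj => (hs j hj).le).trans ?_
          rw [nsmul_eq_mul]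
          exact ENNReal.mul_div_le
      _ < c / 2 + c / 2 :=
          ENNReal.add_lt_add_right (ENNReal.div_ne_top hcfin two_ne_zero) hN
      _ = c := ENNReal.add_halves c
  exact absurd hi this.not_ge

section Cantor

theorem measurableSet_agree {ι : Type*} (p q : ι) (n : ℕ) :
    MeasurableSet {y : ι → ℕ → Bool | ∀ i < n, y p i = y q i} := by
  simp only [Set.ofPred_forall]
  refine MeasurableSet.iInter fun i => MeasurableSet.iInter fun _ => ?_
  exact measurableSet_eq_fun (by fun_prop) (by fun_prop)

theorem isClopen_agree {ι : Type*} (p q : ι) (n : ℕ) :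
    IsClopen {y : ι → ℕ → Bool | ∀ i < n, y p i = y q i} := by
  have : {y : ι → ℕ → Bool | ∀ i < n, y p i = y q i}
      = ⋂ i ∈ Finset.range n, (fun y : ι → ℕ → Bool => (y p i, y q i)) ⁻¹' {b | b.1 = b.2} := by
    ext y; simp
  rw [this]
  exact isClopen_biInter_finset fun i _ => (isClopen_discrete _).preimage (by fun_prop)

variable {ι : Type*} [DecidableEq ι] {μ : Measure (ℕ → Bool)} [IsProbabilityMeasure μ]

theorem measure_agree (hμ : ∀ n (a : ℕ → Bool), μ {v | ∀ i < n, a i = v i} = (1 / 2) ^ n)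
    {p q : ι} (hpq : p ≠ q) (n : ℕ) :
    (Measure.infinitePi fun _ : ι => μ) {y | ∀ i < n, y p i = y q i} = (1 / 2) ^ n := by
  rw [measure_infinitePi_eq_lintegral_update q (measurableSet_agree p q n)]
  simp [Function.update_of_ne hpq, hμ]

theorem le_measure_dbl_inter_agree {p q : ι} (hpq : p ≠ q) {B : Set (ι → ℕ → Bool)}
    (hB : MeasurableSet B) (hq : IndepCoord q B) (m : ℕ) :
    ((Measure.infinitePi fun _ : ι => μ) B / 2 ^ m) ^ 2
      ≤ (Measure.infinitePi fun _ : ι => μ) (dbl p q B ∩ {y | ∀ i < m, y p i = y q i}) := by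
  set ν := Measure.infinitePi fun _ : ι => μ
  let C : (Fin m → Bool) → Set (ι → ℕ → Bool) := fun s => {y | ∀ i : Fin m, y p i = s i}
  have hC : ∀ s, MeasurableSet (C s) := by
    intro s
    simp only [C, Set.ofPred_forall]
    exact MeasurableSet.iInter fun i => measurableSet_eq_fun (by fun_prop) (by fun_prop)
  have hcover : B ⊆ ⋃ s, B ∩ C s := fun y hy =>
    Set.mem_iUnion.2 ⟨fun i => y p i, hy, fun i => rfl⟩
  obtain ⟨s, -, hs⟩ := Finset.exists_max_image Finset.univ (fun s => ν (B ∩ C s))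
    Finset.univ_nonempty
  have hle : ν B / 2 ^ m ≤ ν (B ∩ C s) := by
    refine ENNReal.div_le_of_le_mul' ?_
    calc ν B ≤ ∑ s, ν (B ∩ C s) :=
          (measure_mono hcover).trans (measure_iUnion_fintype_le _ _)
      _ ≤ _ := (Finset.sum_le_card_nsmul _ _ _ fun t ht => hs t ht)
      _ = 2 ^ m * ν (B ∩ C s) := by simp
  have hqC : IndepCoord q (C s) := by
    intro y v
    simp [C, Function.update_of_ne hpq]
  calc (ν B / 2 ^ m) ^ 2 ≤ ν (B ∩ C s) ^ 2 := by gcongr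
    _ ≤ ν (dbl p q (B ∩ C s)) := sq_le_measure_dbl hpq (hB.inter (hC s)) (hq.inter hqC)
    _ ≤ _ := by
      refine measure_mono fun y hy => ?_
      rw [dbl_inter] at hy
      refine ⟨hy.1, fun i hi => ?_⟩
      have h1 := hy.2.1 ⟨i, hi⟩
      have h2 := hy.2.2 ⟨i, hi⟩
      rw [Function.update_self] at h2
      exact h1.trans h2.symm

theorem exists_le_measure_dbl_inter_sdiff
    (hμ : ∀ n (a : ℕ → Bool), μ {v | ∀ i < n, a i = v i} = (1 / 2) ^ n)
    {p q : ι} (hpq : p ≠ q) {c : ENNReal} (hc : c ≠ 0) (hc' : c ≠ ⊤) (m : ℕ) :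
    ∃ n : ℕ, ∃ d : ENNReal, d ≠ 0 ∧ ∀ B : Set (ι → ℕ → Bool), MeasurableSet B →
      IndepCoord q B → c ≤ (Measure.infinitePi fun _ : ι => μ) B →
      d ≤ (Measure.infinitePi fun _ : ι => μ)
        (dbl p q B ∩ ({y | ∀ i < m, y p i = y q i} \ {y | ∀ i < n, y p i = y q i})) := by
  set ν := Measure.infinitePi fun _ : ι => μ
  set e : ENNReal := (c / 2 ^ m) ^ 2 with he
  have he0 : e ≠ 0 := pow_ne_zero _ (ENNReal.div_ne_zero.2 ⟨hc, by simp⟩)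
  have het : e ≠ ⊤ := ENNReal.pow_ne_top (ENNReal.div_ne_top hc' (by simp))
  obtain ⟨n, hn⟩ := ((ENNReal.tendsto_pow_atTop_nhds_zero_of_lt_one
    (r := 1 / 2) (by simp)).eventually_lt_const (ENNReal.half_pos he0)).exists
  refine ⟨n, e / 2, (ENNReal.half_pos he0).ne', fun B hB hq hcB => ?_⟩
  have h1 : e ≤ ν (dbl p q B ∩ {y | ∀ i < m, y p i = y q i}) :=
    le_trans (by rw [he]; gcongr) (le_measure_dbl_inter_agree hpq hB hq m)
  have h2 : ν (dbl p q B ∩ {y | ∀ i < m, y p i = y q i}) ≤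
      ν (dbl p q B ∩ ({y | ∀ i < m, y p i = y q i} \ {y | ∀ i < n, y p i = y q i})) + e / 2 := by
    refine (measure_mono (t := dbl p q B ∩ ({y | ∀ i < m, y p i = y q i} \
      {y | ∀ i < n, y p i = y q i}) ∪ {y | ∀ i < n, y p i = y q i}) ?_).trans
      ((measure_union_le _ _).trans (add_le_add_right ?_ _))
    · intro y hy
      by_cases h : y ∈ {y : ι → ℕ → Bool | ∀ i < n, y p i = y q i}
      · exact Or.inr h
      · exact Or.inl ⟨hy.1, hy.2, h⟩
    · rw [measure_agree hμ hpq]; exact hn.le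
  have h3 := h1.trans h2
  rw [← ENNReal.add_halves e] at h3
  exact (ENNReal.add_le_add_iff_right (ENNReal.div_ne_top het two_ne_zero)).1
    (by simpa [ENNReal.add_halves] using h3)

end Cantor

/-- Iterated doubling: at stage `m` the coordinate `p m` is doubled to the coordinate `inr m`. -/
def iterDbl {α : Type*} (p : ℕ → ℕ ⊕ ℕ) (B : Set (ℕ ⊕ ℕ → α)) : ℕ → Set (ℕ ⊕ ℕ → α)
  | 0 => B
  | m + 1 => dbl (p m) (Sum.inr m) (iterDbl p B m)

section Fusion

variable {p : ℕ → ℕ ⊕ ℕ}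

theorem iterDbl_antitone {α : Type*} (B : Set (ℕ ⊕ ℕ → α)) : Antitone (iterDbl p B) :=
  antitone_nat_of_succ_le fun _ => dbl_subset

theorem isClosed_iterDbl {α : Type*} [TopologicalSpace α] {B : Set (ℕ ⊕ ℕ → α)}
    (hB : IsClosed B) : ∀ m, IsClosed (iterDbl p B m)
  | 0 => hB
  | m + 1 => isClosed_dbl (isClosed_iterDbl hB m)

theorem ne_inr_of_le (hp : ∀ m l, p m = Sum.inr l → l < m) {m l : ℕ} (h : m ≤ l) :
    Sum.inr l ≠ p m := fun e => (hp m l e.symm).not_ge h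

theorem indepCoord_iterDbl {α : Type*} (hp : ∀ m l, p m = Sum.inr l → l < m)
    {B : Set (ℕ ⊕ ℕ → α)} (hB : ∀ l, IndepCoord (Sum.inr l) B) :
    ∀ m l, m ≤ l → IndepCoord (Sum.inr l) (iterDbl p B m)
  | 0, l, _ => hB l
  | m + 1, l, h => (indepCoord_iterDbl hp hB m l (by omega)).dbl
      (ne_inr_of_le hp (by omega)) (by simp; omega)

variable {μ : Measure (ℕ → Bool)} [IsProbabilityMeasure μ]

/-- The invariant of the fusion: the closed set `A` meets, for almost all `i`,
the `m`-fold doubling of `F i` in a set of measure bounded below. -/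
structure FusionInv (μ : Measure (ℕ → Bool)) [IsProbabilityMeasure μ] (U : Ultrafilter ℕ)
    (p : ℕ → ℕ ⊕ ℕ) (F : ℕ → Set (ℕ ⊕ ℕ → ℕ → Bool)) (m : ℕ)
    (A : Set (ℕ ⊕ ℕ → ℕ → Bool)) : Prop where
  closed : IsClosed A
  indep : ∀ l, m ≤ l → IndepCoord (Sum.inr l) A
  pos : ∃ c : ENNReal, c ≠ 0 ∧ ∀ᶠ i in (U : Filter ℕ),
    c ≤ (Measure.infinitePi fun _ : ℕ ⊕ ℕ => μ) (A ∩ iterDbl p (F i) m)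

theorem FusionInv.exists_succ
    (hμ : ∀ n (a : ℕ → Bool), μ {v | ∀ i < n, a i = v i} = (1 / 2) ^ n)
    {U : Ultrafilter ℕ} (hU : (U : Filter ℕ) ≤ atTop)
    (hp : ∀ m l, p m = Sum.inr l → l < m)
    {F : ℕ → Set (ℕ ⊕ ℕ → ℕ → Bool)} (hF : ∀ i, IsClosed (F i))
    (hFi : ∀ i l, IndepCoord (Sum.inr l) (F i)) {m : ℕ} {A : Set (ℕ ⊕ ℕ → ℕ → Bool)}
    (h : FusionInv μ U p F m A) (j₀ : ℕ) :
    ∃ A' j, FusionInv μ U p F (m + 1) A' ∧ j₀ < j ∧ A' ⊆ dbl (p m) (Sum.inr m) A ∧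
      A' ⊆ iterDbl p (F j) (m + 1) ∧
      ∀ y ∈ A', (∀ i < m, y (p m) i = y (Sum.inr m) i) ∧ y (p m) ≠ y (Sum.inr m) := by
  obtain ⟨c, hc, hpos⟩ := h.pos
  have hGc : ∀ i, IsClosed (A ∩ iterDbl p (F i) m) := fun i =>
    h.closed.inter (isClosed_iterDbl (hF i) m)
  have hGi : ∀ i l, m ≤ l → IndepCoord (Sum.inr l) (A ∩ iterDbl p (F i) m) := fun i l hl =>
    (h.indep l hl).inter (indepCoord_iterDbl hp (hFi i) m l hl)
  obtain ⟨j, hj, d, hd, hjd⟩ := exists_eventually_le_measure_inter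
    (Measure.infinitePi fun _ : ℕ ⊕ ℕ => μ) U hU (fun i => A ∩ iterDbl p (F i) m)
    (fun i => (hGc i).measurableSet) hc hpos j₀
  have hdt : d ≠ ⊤ := by
    obtain ⟨i, hi⟩ := hjd.exists
    exact ne_top_of_le_ne_top (measure_ne_top _ _) hi
  have hne : p m ≠ Sum.inr m := (ne_inr_of_le hp le_rfl).symm
  obtain ⟨n, e, he, hstep⟩ := exists_le_measure_dbl_inter_sdiff hμ hne hd hdt m
  set S : Set (ℕ ⊕ ℕ → ℕ → Bool) := {y | ∀ i < m, y (p m) i = y (Sum.inr m) i} \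
    {y | ∀ i < n, y (p m) i = y (Sum.inr m) i} with hS
  refine ⟨dbl (p m) (Sum.inr m) (A ∩ iterDbl p (F j) m) ∩ S, j, ⟨?_, ?_, e, he, ?_⟩, hj, ?_, ?_,
    ?_⟩
  · exact (isClosed_dbl (hGc j)).inter
      ((isClopen_agree _ _ m).isClosed.sdiff (isClopen_agree _ _ n).isOpen)
  · intro l hl
    have h1 : Sum.inr l ≠ p m := ne_inr_of_le hp (by omega)
    have h2 : (Sum.inr l : ℕ ⊕ ℕ) ≠ Sum.inr m := by simp; omega
    refine ((hGi j l (by omega)).dbl h1 h2).inter fun y v => ?_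
    simp [hS, Function.update_of_ne h1.symm, Function.update_of_ne h2.symm]
  · filter_upwards [hjd] with i hi
    refine (hstep _ ((hGc j).inter (hGc i)).measurableSet
      ((hGi j m le_rfl).inter (hGi i m le_rfl)) hi).trans (measure_mono ?_)
    rw [dbl_inter]
    rintro y ⟨⟨hy1, hy2⟩, hy3⟩
    exact ⟨⟨hy1, hy3⟩, dbl_mono Set.inter_subset_right hy2⟩
  · exact fun y hy => dbl_mono Set.inter_subset_left hy.1
  · exact fun y hy => dbl_mono Set.inter_subset_right hy.1
  · rintro y ⟨-, hy1, hy2⟩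
    exact ⟨hy1, fun heq => hy2 fun i _ => by rw [heq]⟩

theorem exists_fusion
    (hμ : ∀ n (a : ℕ → Bool), μ {v | ∀ i < n, a i = v i} = (1 / 2) ^ n)
    {U : Ultrafilter ℕ} (hU : (U : Filter ℕ) ≤ atTop)
    (hp : ∀ m l, p m = Sum.inr l → l < m)
    {F : ℕ → Set (ℕ ⊕ ℕ → ℕ → Bool)} (hF : ∀ i, IsClosed (F i))
    (hFi : ∀ i l, IndepCoord (Sum.inr l) (F i)) {c : ENNReal} (hc : c ≠ 0)
    (hFc : ∀ᶠ i in (U : Filter ℕ), c ≤ (Measure.infinitePi fun _ : ℕ ⊕ ℕ => μ) (F i)) :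
    ∃ φ : ℕ → ℕ, StrictMono φ ∧ ∃ z : ℕ ⊕ ℕ → ℕ → Bool,
      (∀ l m, z ∈ iterDbl p (F (φ l)) m) ∧
      ∀ m, (∀ i < m, z (p m) i = z (Sum.inr m) i) ∧ z (p m) ≠ z (Sum.inr m) := by
  choose! A' j' hinv hlt hsub hF' hsep using
    fun m A (h : FusionInv μ U p F m A) j₀ => h.exists_succ hμ hU hp hF hFi j₀
  let s : ℕ → Set (ℕ ⊕ ℕ → ℕ → Bool) × ℕ := fun m =>
    Nat.rec (Set.univ, 0) (fun m s => (A' m s.1 s.2, j' m s.1 s.2)) m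
  have hs : ∀ m, FusionInv μ U p F m (s m).1 := by
    intro m
    induction m with
    | zero =>
      refine ⟨isClosed_univ, fun l _ y v => by simp [s], c, hc, ?_⟩
      simpa [s, iterDbl] using hFc
    | succ m ih => exact hinv m _ ih _
  have hanti : Antitone fun m => (s m).1 :=
    antitone_nat_of_succ_le fun m => (hsub m _ (hs m) _).trans dbl_subset
  obtain ⟨z, hz⟩ : (⋂ m, (s m).1).Nonempty := by
    refine IsCompact.nonempty_iInter_of_sequence_nonempty_isCompact_isClosed _
      (fun m => hanti m.le_succ) (fun m => ?_) (hs 0).closed.isCompact fun m => (hs m).closed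
    obtain ⟨c, hc, h⟩ := (hs m).pos
    obtain ⟨i, hi⟩ := h.exists
    exact (nonempty_of_measure_ne_zero (ne_of_gt (hc.bot_lt.trans_le hi))).mono
      Set.inter_subset_left
  rw [Set.mem_iInter] at hz
  refine ⟨fun l => (s (l + 1)).2,
    strictMono_nat_of_lt_succ fun l => hlt (l + 1) _ (hs (l + 1)) _, z, fun l m => ?_,
    fun m => hsep m _ (hs m) _ z (hz (m + 1))⟩
  have key : ∀ k, (s (l + 1 + k)).1 ⊆ iterDbl p (F (s (l + 1)).2) (l + 1 + k) := by
    intro k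
    induction k with
    | zero => exact hF' l _ (hs l) _
    | succ k ih => exact (hsub (l + 1 + k) _ (hs _) _).trans (dbl_mono ih)
  exact iterDbl_antitone _ (by omega) (key m (hz _))

end Fusion

/-- A schedule of doublings which keeps track of colours and visits every point infinitely often. -/
theorem exists_doubling_schedule :
    ∃ (p : ℕ → ℕ ⊕ ℕ) (col : ℕ ⊕ ℕ → ℕ), (∀ k, col (Sum.inl k) = k) ∧
      (∀ m, col (Sum.inr m) = col (p m)) ∧ (∀ m l, p m = Sum.inr l → l < m) ∧
      ∀ i n, ∃ m ≥ n, p m = i := by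
  let p : ℕ → ℕ ⊕ ℕ := fun m =>
    if m.unpair.2.unpair.1 ≠ 0 ∧ (m.unpair.2.unpair.1 - 1).unpair.1 = m.unpair.1 then
      Sum.inr (m.unpair.2.unpair.1 - 1) else Sum.inl m.unpair.1
  refine ⟨p, Sum.elim id fun m => m.unpair.1, fun k => rfl, fun m => ?_, fun m l h => ?_, ?_⟩
  · by_cases h : m.unpair.2.unpair.1 ≠ 0 ∧ (m.unpair.2.unpair.1 - 1).unpair.1 = m.unpair.1
    · simp only [p, if_pos h, Sum.elim_inr, h.2]
    · simp only [p, if_neg h, Sum.elim_inl, Sum.elim_inr, id]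
  · by_cases h' : m.unpair.2.unpair.1 ≠ 0 ∧ (m.unpair.2.unpair.1 - 1).unpair.1 = m.unpair.1
    · simp only [p, if_pos h', Sum.inr.injEq] at h
      have h1 := Nat.unpair_left_le m.unpair.2
      have h2 := Nat.unpair_right_le m
      have h3 := h'.1
      omega
    · simp [p, if_neg h'] at h
  · rintro (k | l) n
    · refine ⟨Nat.pair k (Nat.pair 0 n),
        (Nat.right_le_pair 0 n).trans (Nat.right_le_pair k _), ?_⟩
      simp [p]
    · refine ⟨Nat.pair l.unpair.1 (Nat.pair (l + 1) n),
        (Nat.right_le_pair (l + 1) n).trans (Nat.right_le_pair _ _), ?_⟩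
      simp [p]

theorem mem_of_mem_iterDbl {α : Type*} {p : ℕ → ℕ ⊕ ℕ} {col : ℕ ⊕ ℕ → ℕ}
    (hl : ∀ k, col (Sum.inl k) = k) (hr : ∀ m, col (Sum.inr m) = col (p m))
    (hp : ∀ m l, p m = Sum.inr l → l < m) (K : Set (ℕ → α)) (M : ℕ) :
    ∀ y ∈ iterDbl p {y | (fun k => y (Sum.inl k)) ∈ K} M, ∀ t : ℕ → ℕ ⊕ ℕ,
      (∀ k, col (t k) = k) → (∀ k l, t k = Sum.inr l → l < M) → (fun k => y (t k)) ∈ K := by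
  induction M with
  | zero =>
    intro y hy t ht hM
    have : t = Sum.inl := by
      funext k
      rcases h : t k with k' | l
      · have := ht k
        rw [h, hl] at this
        rw [this]
      · exact absurd (hM k l h) (Nat.not_lt_zero l)
    rw [this]; exact hy
  | succ M ih =>
    intro y hy t ht hM
    by_cases hex : ∃ k, t k = Sum.inr M
    · obtain ⟨k₀, hk₀⟩ := hex
      have hcol : col (p M) = k₀ := by rw [← hr, ← hk₀, ht]
      have := ih _ hy.2 (Function.update t k₀ (p M)) ?_ ?_
      · convert this using 2 with k
        by_cases hk : k = k₀
        · subst hk; simp [hk₀]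
        · rw [Function.update_of_ne hk, Function.update_of_ne]
          intro h
          exact hk (by rw [← ht k, h, hcol])
      · intro k
        by_cases hk : k = k₀
        · subst hk; simpa using hcol
        · rw [Function.update_of_ne hk, ht]
      · intro k l hkl
        by_cases hk : k = k₀
        · subst hk; exact hp M l (by simpa using hkl)
        · rw [Function.update_of_ne hk] at hkl
          refine lt_of_le_of_ne (Nat.lt_succ_iff.1 (hM k l hkl)) ?_
          rintro rfl
          exact hk (by rw [← ht k, hkl, hr, hcol])
    · refine ih y hy.1 t ht fun k l hkl => lt_of_le_of_ne (Nat.lt_succ_iff.1 (hM k l hkl)) ?_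
      rintro rfl
      exact hex ⟨k, hkl⟩

/-- A closed set containing all finitely supported tuples from `z` contains the product of the
closures of the colour classes. -/
theorem mem_of_mem_closure_of_mem_iterDbl {α : Type*} [TopologicalSpace α]
    [FirstCountableTopology α] {p : ℕ → ℕ ⊕ ℕ} {col : ℕ ⊕ ℕ → ℕ}
    (hl : ∀ k, col (Sum.inl k) = k) (hr : ∀ m, col (Sum.inr m) = col (p m))
    (hp : ∀ m l, p m = Sum.inr l → l < m) {K : Set (ℕ → α)} (hK : IsClosed K)
    {z : ℕ ⊕ ℕ → α} (hz : ∀ M, z ∈ iterDbl p {y | (fun k => y (Sum.inl k)) ∈ K} M)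
    {x : ℕ → α} (hx : ∀ k, x k ∈ closure (z '' {i | col i = k})) : x ∈ K := by
  have h1 : ∀ k, ∃ i : ℕ → ℕ ⊕ ℕ, (∀ n, col (i n) = k) ∧
      Tendsto (fun n => z (i n)) atTop (nhds (x k)) := by
    intro k
    obtain ⟨u, hu, hlim⟩ := mem_closure_iff_seq_limit.1 (hx k)
    choose i hi hiu using hu
    exact ⟨i, hi, by simpa only [hiu] using hlim⟩
  choose i hi hlim using h1
  let t : ℕ → ℕ → ℕ ⊕ ℕ := fun n k => if k < n then i k n else Sum.inl k
  refine hK.mem_of_tendsto (f := fun n k => z (t n k)) (b := atTop)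
    (tendsto_pi_nhds.2 fun k => (hlim k).congr' ?_) (Eventually.of_forall fun n => ?_)
  · filter_upwards [eventually_gt_atTop k] with n hn
    simp [t, hn]
  · refine mem_of_mem_iterDbl hl hr hp K
      ((Finset.range n).sup (fun k => Sum.elim (fun _ => 0) (fun l => l + 1) (i k n))) z (hz _)
      (t n) (fun k => ?_) fun k l hkl => ?_
    · by_cases hk : k < n
      · simp [t, hk, hi]
      · simp [t, hk, hl]
    · by_cases hk : k < n
      · simp only [t, if_pos hk] at hkl
        have := Finset.le_sup (f := fun k => Sum.elim (fun _ => 0) (fun l => l + 1) (i k n))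
          (Finset.mem_range.2 hk)
        simp only [hkl, Sum.elim_inr] at this
        exact this
      · simp [t, hk] at hkl

theorem perfect_closure_image {p : ℕ → ℕ ⊕ ℕ} {col : ℕ ⊕ ℕ → ℕ}
    (hr : ∀ m, col (Sum.inr m) = col (p m)) (hinf : ∀ i n, ∃ m ≥ n, p m = i)
    {z : ℕ ⊕ ℕ → ℕ → Bool}
    (hz : ∀ m, (∀ i < m, z (p m) i = z (Sum.inr m) i) ∧ z (p m) ≠ z (Sum.inr m)) (k : ℕ) :
    Perfect (closure (z '' {i | col i = k})) := by
  refine Preperfect.perfect_closure (preperfect_iff_nhds.2 ?_)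
  rintro _ ⟨i, hi, rfl⟩ V hV
  choose m hm hmi using hinf i
  have hlim : Tendsto (fun n => z (Sum.inr (m n))) atTop (nhds (z i)) := by
    refine tendsto_pi_nhds.2 fun a => tendsto_const_nhds.congr' ?_
    filter_upwards [eventually_gt_atTop a] with n hn
    rw [← (hz (m n)).1 a (hn.trans_le (hm n)), hmi]
  obtain ⟨n, hn⟩ := (hlim.eventually_mem hV).exists
  refine ⟨_, ⟨hn, Sum.inr (m n), ?_, rfl⟩, ?_⟩
  · rw [Set.mem_ofPred_eq, hr, hmi]; exact hi
  · have := (hz (m n)).2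
    rw [hmi] at this
    exact this.symm

/-- Closed sets with measure bounded below along an ultrafilter: infinitely many of them contain
a common product of perfect sets. -/
theorem exists_pi_perfect_subset {μ : Measure (ℕ → Bool)} [IsProbabilityMeasure μ]
    (hμ : ∀ n (a : ℕ → Bool), μ {v | ∀ i < n, a i = v i} = (1 / 2) ^ n)
    {U : Ultrafilter ℕ} (hU : (U : Filter ℕ) ≤ atTop) {K : ℕ → Set (ℕ → ℕ → Bool)}
    (hK : ∀ i, IsClosed (K i)) {c : ENNReal} (hc : c ≠ 0)
    (hKc : ∀ᶠ i in (U : Filter ℕ), c ≤ (Measure.infinitePi fun _ : ℕ => μ) (K i)) :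
    ∃ φ : ℕ → ℕ, StrictMono φ ∧ ∃ P : ℕ → Set (ℕ → Bool),
      (∀ k, (P k).Nonempty ∧ Perfect (P k)) ∧ ∀ l, Set.pi Set.univ P ⊆ K (φ l) := by
  obtain ⟨p, col, hl, hr, hp, hinf⟩ := exists_doubling_schedule
  have hρm : Measurable fun (y : ℕ ⊕ ℕ → ℕ → Bool) k => y (Sum.inl k) := by fun_prop
  have hρ : MeasurePreserving (fun (y : ℕ ⊕ ℕ → ℕ → Bool) k => y (Sum.inl k))
      (Measure.infinitePi fun _ : ℕ ⊕ ℕ => μ) (Measure.infinitePi fun _ : ℕ => μ) := by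
    refine ⟨hρm, Measure.eq_infinitePi _ fun s t ht => ?_⟩
    rw [Measure.map_apply hρm (MeasurableSet.pi s.countable_toSet fun i _ => ht i)]
    have : (fun (y : ℕ ⊕ ℕ → ℕ → Bool) k => y (Sum.inl k)) ⁻¹' Set.pi s t
        = Set.pi (s.map Function.Embedding.inl : Finset (ℕ ⊕ ℕ)) (Sum.elim t fun _ => Set.univ) := by
      ext y; simp
    rw [this, Measure.infinitePi_pi]
    · simp
    · rintro (i | i) - <;> simp [ht]
  obtain ⟨φ, hφ, z, hzF, hz⟩ := exists_fusion hμ hU hp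
    (F := fun i => {y | (fun k => y (Sum.inl k)) ∈ K i})
    (fun i => (hK i).preimage (by fun_prop)) (fun i l y v => by simp) hc (by
      filter_upwards [hKc] with i hi
      exact hi.trans_eq (hρ.measure_preimage (hK i).nullMeasurableSet).symm)
  refine ⟨φ, hφ, fun k => closure (z '' {i | col i = k}), fun k => ⟨?_, ?_⟩, fun l x hx => ?_⟩
  · exact Set.Nonempty.closure ⟨_, Sum.inl k, hl k, rfl⟩
  · exact perfect_closure_image hr hinf hz k
  · exact mem_of_mem_closure_of_mem_iterDbl hl hr hp (hK _) (hzF l) fun k => hx k trivial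

theorem stmt15 (μ : Measure (ℕ → Bool)) [IsProbabilityMeasure μ]
    (hμ : ∀ s : List Bool,
      μ {x | ∀ i : Fin s.length, x i = s.get i} = (1 / 2 : ENNReal) ^ s.length)
    (μω : Measure (ℕ → (ℕ → Bool))) [IsProbabilityMeasure μω]
    (hμω : ∀ (n : ℕ) (S : Fin n → Set (ℕ → Bool)), (∀ k, MeasurableSet (S k)) →
      μω {x | ∀ k : Fin n, x k ∈ S k} = ∏ k, μ (S k))
    (f : ℕ → (ℕ → (ℕ → Bool)) → Bool)
    (hf : ∀ n, NullMeasurable (f n) μω) :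
    ∃ φ : ℕ → ℕ, StrictMono φ ∧
      ∃ P : ℕ → Set (ℕ → Bool),
        (∀ k, (P k).Nonempty ∧ Perfect (P k)) ∧
        ∀ x ∈ Set.pi Set.univ P, ∃ b : Bool,
          Tendsto (fun i => f (φ i) x) atTop (nhds b) := by
  have hcyl : ∀ n (a : ℕ → Bool), μ {v | ∀ i < n, a i = v i} = (1 / 2) ^ n := by
    intro n a
    have h := hμ (List.ofFn fun i : Fin n => a i)
    have hlen : (List.ofFn fun i : Fin n => a i).length = n := List.length_ofFn
    refine Eq.trans ?_ (h.trans (by rw [hlen]))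
    congr 1
    ext v
    simp only [Set.mem_ofPred_eq, List.get_ofFn]
    constructor
    · intro hv i
      exact (hv i (by simpa using i.2)).symm
    · intro hv i hi
      exact (hv ⟨i, by simpa using hi⟩).symm
  have hprod : μω = Measure.infinitePi fun _ : ℕ => μ := by
    refine Measure.eq_infinitePi _ fun s t ht => ?_
    classical
    obtain ⟨n, hn⟩ := s.exists_nat_subset_range
    have h := hμω n (fun k => if (k : ℕ) ∈ s then t k else Set.univ) fun k => by
      split_ifs
      · exact ht k
      · exact MeasurableSet.univ
    rw [Fin.prod_univ_eq_prod_range (fun k => μ (if k ∈ s then t k else Set.univ)) n,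
      ← Finset.prod_subset hn (fun k _ hk => by simp [hk]),
      Finset.prod_congr rfl (fun k hk => by rw [if_pos hk])] at h
    rw [← h]
    congr 1
    ext x
    simp only [Set.mem_pi, Finset.mem_coe, Set.mem_ofPred_eq]
    constructor
    · intro hx k
      split_ifs with hk
      · exact hx k hk
      · trivial
    · intro hx k hk
      simpa [hk] using hx ⟨k, Finset.mem_range.1 (hn hk)⟩
  have hU : ((hyperfilter ℕ : Ultrafilter ℕ) : Filter ℕ) ≤ atTop := Nat.hyperfilter_le_atTop
  obtain ⟨b, hb⟩ : ∃ b : Bool, ∀ᶠ i in (hyperfilter ℕ : Filter ℕ), 1 / 2 ≤ μω (f i ⁻¹' {b}) := by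
    have : ∀ i, 1 / 2 ≤ μω (f i ⁻¹' {true}) ∨ 1 / 2 ≤ μω (f i ⁻¹' {false}) := by
      intro i
      by_contra! hcon
      have h1 : (1 : ENNReal) ≤ μω (f i ⁻¹' {true}) + μω (f i ⁻¹' {false}) := by
        rw [← measure_univ (μ := μω)]
        refine (measure_mono fun x _ => ?_).trans (measure_union_le _ _)
        cases h : f i x <;> simp [h]
      have h2 := ENNReal.add_lt_add hcon.1 hcon.2
      rw [ENNReal.add_halves] at h2
      exact absurd h1 h2.not_ge
    rcases Ultrafilter.eventually_or.1 (Eventually.of_forall (f := (hyperfilter ℕ : Filter ℕ)) this)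
      with h | h
    · exact ⟨true, h⟩
    · exact ⟨false, h⟩
  have hK : ∀ i, ∃ K ⊆ f i ⁻¹' {b}, IsClosed K ∧
      (1 / 2 ≤ μω (f i ⁻¹' {b}) → 1 / 4 ≤ μω K) := by
    intro i
    obtain ⟨t, hts, ht, hae⟩ :=
      (hf i (measurableSet_singleton b)).exists_measurable_subset_ae_eq
    obtain ⟨K, hKt, hK, hlt⟩ := ht.exists_isClosed_lt_add (measure_ne_top μω t)
      (ε := 1 / 4) (by simp)
    refine ⟨K, hKt.trans hts, hK, fun h => ?_⟩
    rw [measure_congr hae] at hlt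
    have h4 : (1 / 2 : ENNReal) = 1 / 4 + 1 / 4 := by
      rw [← ENNReal.toReal_eq_toReal_iff' (by simp) (by simp)]
      rw [ENNReal.toReal_add (by simp) (by simp)]
      norm_num
    have := h.trans hlt.le
    rw [h4] at this
    exact (ENNReal.add_le_add_iff_right (by simp)).1 this
  choose K hKf hKc hKm using hK
  obtain ⟨φ, hφ, P, hP, hsub⟩ := exists_pi_perfect_subset hcyl hU hKc (c := 1 / 4) (by simp) (by
    filter_upwards [hb] with i hi
    rw [← hprod]
    exact hKm i hi)
  refine ⟨φ, hφ, P, hP, fun x hx => ⟨b, tendsto_const_nhds.congr fun i => ?_⟩⟩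
  exact (hKf _ (hsub i hx)).symm
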